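/- Let μ be a probability measure on M with periodic repetitive pattern, let ν = π_*μ be its projection to Σ_k and {μ_ξ} its Rokhlin disintegration along the fibers {ξ}×S¹. Then μ has atoms in its disintegration: there exists a measurable set W ⊆ Σ_k with ν(W) > 0 such that for every ξ ∈ W the conditional measure μ_ξ has an atom. -/

import Mathlib

open MeasureTheory Filter Set
open scoped ENNReal NNReal

noncomputable section

/-- The two-sided full shift space on `k` symbols. -/
abbrev Shift (k : ℕ) := ℤ → Fin k

/-- The shift map `σ`. -/
def shiftMap (k : ℕ) : Shift k → Shift k := fun ξ i => ξ (i + 1)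

/-- The circle `S¹`, modelled as `ℝ/ℤ`. -/
abbrev Circle1 := AddCircle (1 : ℝ)

/-- The phase space `M = Σ_k × S¹`. -/
abbrev SkewM (k : ℕ) := Shift k × Circle1

/-- Canonical projection `ℝ → S¹`. -/
def projCircle : ℝ → Circle1 := fun x => (x : Circle1)

/-- A locally constant skew product system over the full shift with circle fibers:
the fiber maps `f j` are `C¹` diffeomorphisms of the circle, recorded together with
lifts `F j : ℝ → ℝ`. -/
structure SkewSetup (k : ℕ) where
  f : Fin k → Circle1 → Circle1
  F : Fin k → ℝ → ℝ
  compat : ∀ j (x : ℝ), f j (projCircle x) = projCircle (F j x)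
  F_equiv : ∀ j x, F j (x + 1) = F j x + 1
  F_smooth : ∀ j, ContDiff ℝ 1 (F j)
  F_bij : ∀ j, Function.Bijective (F j)
  Finv_smooth : ∀ j, ContDiff ℝ 1 (Function.invFun (F j))

/-- The skew product map `T(ξ,x) = (σξ, f_{ξ₀} x)`. -/
def SkewSetup.T {k : ℕ} (S : SkewSetup k) : SkewM k → SkewM k :=
  fun z => (shiftMap k z.1, S.f (z.1 0) z.2)

/-- The composition `f_{w (m-1)} ∘ ⋯ ∘ f_{w 0}` of the fiber maps along a word `w`. -/
def SkewSetup.wordComp {k : ℕ} (S : SkewSetup k) (w : ℕ → Fin k) : ℕ → Circle1 → Circle1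
  | 0 => id
  | m + 1 => S.f (w m) ∘ S.wordComp w m

/-- The corresponding composition of the lifts. -/
def SkewSetup.wordCompLift {k : ℕ} (S : SkewSetup k) (w : ℕ → Fin k) : ℕ → ℝ → ℝ
  | 0 => id
  | m + 1 => S.F (w m) ∘ S.wordCompLift w m

/-- A sequence of `T`-periodic orbits with repetitive pattern (Definition 2.2 of the paper).
The `n`-th periodic point is `(ξ n, q n)` where `ξ n` is the infinite repetition of the
word `w n 0, …, w n (π n - 1)`; the intervals `J n ⊆ S¹` are the arcs
`projCircle '' Icc (a n) (b n)`. -/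
structure RepetitivePattern {k : ℕ} (S : SkewSetup k) where
  /-- the periods -/
  π : ℕ → ℕ
  π_pos : ∀ n, 0 < π n
  /-- the words (`w n i` is the letter `ω^n_{i+1}` of the paper) -/
  w : ℕ → ℕ → Fin k
  /-- the fiber coordinates of the periodic points -/
  q : ℕ → Circle1
  /-- endpoints of (lifts of) the intervals `J n` -/
  a : ℕ → ℝ
  b : ℕ → ℝ
  a_lt_b : ∀ n, a n < b n
  nested : ∀ n, Icc (a (n + 1)) (b (n + 1)) ⊆ Icc (a n) (b n)
  len_lt : ∀ n, b (n + 1) - a (n + 1) < b n - a n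
  len_to_zero : Tendsto (fun n => b n - a n) atTop (nhds 0)
  q_mem : ∀ n, q n ∈ projCircle '' Icc (a n) (b n)
  /-- `J 0, f_{ω^0_1}(J 0), …, f_{ω^0_{π 0 - 1}}∘⋯∘f_{ω^0_1}(J 0)` are pairwise disjoint -/
  disjoint0 : ∀ ℓ₁ ℓ₂, ℓ₁ < ℓ₂ → ℓ₂ < π 0 →
    Disjoint (S.wordComp (w 0) ℓ₁ '' (projCircle '' Icc (a 0) (b 0)))
             (S.wordComp (w 0) ℓ₂ '' (projCircle '' Icc (a 0) (b 0)))
  /-- `q n` is fixed by `g n = f_{ω^n_{π n}} ∘ ⋯ ∘ f_{ω^n_1}` -/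
  fixed : ∀ n, S.wordComp (w n) (π n) (q n) = q n
  /-- `|g_n'| < 1` on `J n` -/
  contracting : ∀ n, ∀ x ∈ Icc (a n) (b n), |deriv (S.wordCompLift (w n) (π n)) x| < 1
  /-- the numbers `k_n` (for `n ≥ 1`) -/
  kseq : ℕ → ℕ
  /-- the numbers `R_n` (for `n ≥ 1`) -/
  Rseq : ℕ → ℕ
  kseq_ge : ∀ n, 2 ≤ kseq (n + 1)
  Rseq_ge : ∀ n, 1 ≤ Rseq (n + 1)
  /-- `g (n+1) = T_{R (n+1)} ∘ (g n)^{k (n+1)}`, encoded on the level of words: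
  the word of `ξ (n+1)` is `k (n+1)` repetitions of the word of `ξ n` followed by a
  word of length `R (n+1)` -/
  period_eq : ∀ n, π (n + 1) = kseq (n + 1) * π n + Rseq (n + 1)
  word_eq : ∀ n, ∀ i < kseq (n + 1) * π n, w (n + 1) i = w n (i % π n)
  /-- the sequence `λ_n = R_n / (k_n π_{n-1})` is summable -/
  lam_summable : Summable fun n => (Rseq (n + 1) : ℝ) / (kseq (n + 1) * π n)

namespace RepetitivePattern

variable {k : ℕ} {S : SkewSetup k}

/-- The `σ`-periodic point `ξ n`, the infinite repetition of the `n`-th word. -/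
def ξp (P : RepetitivePattern S) (n : ℕ) : Shift k :=
  fun i => P.w n (Int.toNat (i % (P.π n : ℤ)))

/-- The measure `μ_{X_n}`, uniformly distributed on the `n`-th periodic orbit. -/
def μX (P : RepetitivePattern S) (n : ℕ) : Measure (SkewM k) :=
  (P.π n : ℝ≥0∞)⁻¹ • ∑ ℓ ∈ Finset.range (P.π n), Measure.dirac (S.T^[ℓ] (P.ξp n, P.q n))

/-- The projected measure `ν_n`, uniformly distributed on the `σ`-orbit of `ξ n`. -/
def νX (P : RepetitivePattern S) (n : ℕ) : Measure (Shift k) :=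
  (P.π n : ℝ≥0∞)⁻¹ • ∑ ℓ ∈ Finset.range (P.π n), Measure.dirac ((shiftMap k)^[ℓ] (P.ξp n))

end RepetitivePattern

/-- Weak-star convergence of a sequence of measures. -/
def WeakStarTendsto {X : Type*} [TopologicalSpace X] [MeasurableSpace X]
    (μs : ℕ → Measure X) (μ : Measure X) : Prop :=
  ∀ g : C(X, ℝ), Tendsto (fun n => ∫ x, g x ∂(μs n)) atTop (nhds (∫ x, g x ∂μ))

/-- A probability measure on `M` has periodic repetitive pattern if it is the weak-star
limit of the measures `μ_{X_n}` for some sequence of periodic orbits with repetitive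
pattern. -/
def HasPeriodicRepetitivePattern {k : ℕ} (S : SkewSetup k) (μ : Measure (SkewM k)) : Prop :=
  ∃ P : RepetitivePattern S, WeakStarTendsto (fun n => P.μX n) μ

/-- The Kolmogorov–Sinai (measure-theoretic) entropy of `T` with respect to `μ`:
the supremum, over all finite measurable colorings `c : X → Fin m`, of the entropy of the
associated process, the latter being computed (via subadditivity) as the infimum of
`H_n/n` where `H_n` is the Shannon entropy of the partition of `X` according to the
itinerary `(c x, c (T x), …, c (T^{n-1} x))`. -/
def ksEntropy {X : Type*} [MeasurableSpace X] (T : X → X) (μ : Measure X) : ℝ≥0∞ :=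
  ⨆ (m : ℕ) (c : {c : X → Fin m // Measurable c}),
    ⨅ n : ℕ, ENNReal.ofReal
      ((∑ s : Fin (n + 1) → Fin m,
        Real.negMulLog ((μ {x | ∀ i : Fin (n + 1), c.1 (T^[(i : ℕ)] x) = s i}).toReal))
        / ((n : ℝ) + 1))


/-- A family `md ξ` of measures is a (Rokhlin) disintegration of `μ` along the vertical
fibers `{ξ} × S¹`, with respect to the projection `ν` of `μ` to the base: almost every
`md ξ` is a probability measure concentrated on the fiber over `ξ`, and `μ` is the
integral of the family against `ν`. -/
def IsDisintegration {k : ℕ} (μ : Measure (SkewM k)) (ν : Measure (Shift k))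
    (md : Shift k → Measure (SkewM k)) : Prop :=
  (∀ᵐ ξ ∂ν, IsProbabilityMeasure (md ξ)) ∧
  (∀ᵐ ξ ∂ν, md ξ ({ξ} ×ˢ (Set.univ : Set Circle1)) = 1) ∧
  (∀ A : Set (SkewM k), MeasurableSet A → μ A = ∫⁻ ξ, md ξ A ∂ν)

/-- A measure is (purely) atomic if it is carried by a countable set. -/
def IsAtomicMeasure {X : Type*} [MeasurableSpace X] (m : Measure X) : Prop :=
  ∃ s : Set X, s.Countable ∧ m sᶜ = 0

theorem finite_of_forall_exists_coloring {X : Type*} [MetricSpace X] {A : Set X} {p : ℕ}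
    (h : ∀ ε > 0, ∃ c : X → ℕ, (∀ x ∈ A, c x < p) ∧
      ∀ x ∈ A, ∀ y ∈ A, c x = c y → dist x y < ε) : A.Finite := by
  by_contra hA
  obtain ⟨t, htA, ht⟩ := Set.Infinite.exists_subset_card_eq hA (p + 1)
  have hsep : ∀ᶠ ε : ℝ in nhdsWithin 0 (Ioi 0), ∀ z ∈ t.offDiag, ε < dist z.1 z.2 := by
    rw [Finset.eventually_all]
    intro z hz
    exact nhdsWithin_le_nhds (eventually_lt_nhds (dist_pos.2 (Finset.mem_offDiag.1 hz).2.2))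
  obtain ⟨ε, hsep, hε⟩ := (hsep.and self_mem_nhdsWithin).exists
  obtain ⟨c, hc, hdist⟩ := h ε hε
  obtain ⟨x, hx, y, hy, hxy, heq⟩ := Finset.exists_ne_map_eq_of_card_lt_of_maps_to
    (s := t) (t := Finset.range p) (f := c) (by simp [ht])
    fun x hx => by simpa using hc x (htA hx)
  exact (hdist x (htA hx) y (htA hy) heq).not_gt
    (hsep (x, y) (Finset.mem_offDiag.2 ⟨hx, hy, hxy⟩))

theorem shiftMap_iterate_apply (k n : ℕ) (ξ : Shift k) (i : ℤ) :
    (shiftMap k)^[n] ξ i = ξ (i + n) := by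
  induction n generalizing ξ with
  | zero => simp
  | succ n ih =>
    rw [Function.iterate_succ_apply, ih, shiftMap]
    congr 1
    push_cast
    ring

theorem continuous_projCircle : Continuous projCircle := AddCircle.continuous_mk' 1

theorem dist_projCircle_le (x y : ℝ) : dist (projCircle x) (projCircle y) ≤ |x - y| := by
  rw [dist_eq_norm]
  exact QuotientAddGroup.norm_mk_le_norm

theorem projCircle_eq_iff (x y : ℝ) : projCircle x = projCircle y ↔ ∃ m : ℤ, y = x + m := by
  have h : projCircle x = projCircle y ↔ ((y - x : ℝ) : AddCircle (1 : ℝ)) = 0 := by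
    rw [AddCircle.coe_sub, sub_eq_zero, eq_comm]
    rfl
  rw [h, AddCircle.coe_eq_zero_iff]
  refine exists_congr fun m => ?_
  rw [zsmul_eq_mul, mul_one]
  constructor <;> intro h <;> linarith

theorem sub_lt_sub_of_abs_deriv_lt_one {G : ℝ → ℝ} (hG : Differentiable ℝ G) {x y : ℝ}
    (hxy : x < y) (h : ∀ z ∈ Icc x y, |deriv G z| < 1) : G y - G x < y - x := by
  obtain ⟨c, hc, hc'⟩ := exists_deriv_eq_slope G hxy hG.continuous.continuousOn
    hG.differentiableOn
  have h1 := (abs_lt.1 (h c (Ioo_subset_Icc_self hc))).2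
  rwa [hc', div_lt_one (sub_pos.2 hxy)] at h1

namespace SkewSetup

variable {k : ℕ} (S : SkewSetup k)

theorem F_strictMono (j : Fin k) : StrictMono (S.F j) := by
  rcases (S.F_smooth j).continuous.strictMono_of_inj (S.F_bij j).1 with h | h
  · exact h
  · have h1 := h (zero_lt_one' ℝ)
    have h2 := S.F_equiv j 0
    rw [zero_add] at h2
    linarith

theorem continuous_f (j : Fin k) : Continuous (S.f j) := by
  have hq : Topology.IsQuotientMap projCircle := QuotientAddGroup.isQuotientMap_mk _
  rw [hq.continuous_iff]
  have : S.f j ∘ projCircle = projCircle ∘ S.F j := funext fun x => S.compat j x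
  rw [this]
  exact continuous_projCircle.comp (S.F_smooth j).continuous

theorem continuous_wordComp (w : ℕ → Fin k) (m : ℕ) : Continuous (S.wordComp w m) := by
  induction m with
  | zero => exact continuous_id
  | succ m ih => exact (S.continuous_f _).comp ih

theorem wordComp_projCircle (w : ℕ → Fin k) (m : ℕ) (x : ℝ) :
    S.wordComp w m (projCircle x) = projCircle (S.wordCompLift w m x) := by
  induction m with
  | zero => rfl
  | succ m ih => rw [wordComp, Function.comp_apply, ih, S.compat]; rfl

theorem strictMono_wordCompLift (w : ℕ → Fin k) (m : ℕ) : StrictMono (S.wordCompLift w m) := by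
  induction m with
  | zero => exact strictMono_id
  | succ m ih => exact (S.F_strictMono _).comp ih

theorem differentiable_wordCompLift (w : ℕ → Fin k) (m : ℕ) :
    Differentiable ℝ (S.wordCompLift w m) := by
  induction m with
  | zero => exact differentiable_id
  | succ m ih => exact ((S.F_smooth _).differentiable one_ne_zero).comp ih

theorem wordCompLift_add_one (w : ℕ → Fin k) (m : ℕ) (x : ℝ) :
    S.wordCompLift w m (x + 1) = S.wordCompLift w m x + 1 := by
  induction m with
  | zero => rfl
  | succ m ih => simp only [wordCompLift, Function.comp_apply, ih, S.F_equiv]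

theorem wordComp_congr {w w' : ℕ → Fin k} {m : ℕ} (h : ∀ i < m, w i = w' i) :
    S.wordComp w m = S.wordComp w' m := by
  induction m with
  | zero => rfl
  | succ m ih =>
    rw [wordComp, wordComp, h m m.lt_succ_self, ih fun i hi => h i (hi.trans m.lt_succ_self)]

theorem T_iterate (ξ : Shift k) (z : Circle1) (m : ℕ) :
    S.T^[m] (ξ, z) = ((shiftMap k)^[m] ξ, S.wordComp (fun i => ξ i) m z) := by
  induction m with
  | zero => rfl
  | succ m ih =>
    rw [Function.iterate_succ_apply', ih, T, Function.iterate_succ_apply']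
    simp [shiftMap_iterate_apply, wordComp]

end SkewSetup

namespace RepetitivePattern

variable {k : ℕ} {S : SkewSetup k} (P : RepetitivePattern S)

theorem ξp_natCast (n i : ℕ) : P.ξp n i = P.w n (i % P.π n) := by
  simp only [ξp]
  congr 1

theorem shiftMap_iterate_π_ξp (n : ℕ) : (shiftMap k)^[P.π n] (P.ξp n) = P.ξp n := by
  funext i
  rw [shiftMap_iterate_apply]
  simp [ξp]

theorem ξp_succ_natCast {n i : ℕ} (hi : i < P.kseq (n + 1) * P.π n) :
    P.ξp (n + 1) i = P.ξp n i := by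
  rw [ξp_natCast, ξp_natCast, Nat.mod_eq_of_lt, P.word_eq n i hi]
  rw [P.period_eq]
  omega

/-- The first return map `g n` of the `n`-th periodic orbit. -/
def returnMap (n : ℕ) : Circle1 → Circle1 := S.wordComp (P.w n) (P.π n)

theorem T_iterate_π (n : ℕ) (z : Circle1) :
    S.T^[P.π n] (P.ξp n, z) = (P.ξp n, P.returnMap n z) := by
  rw [S.T_iterate, shiftMap_iterate_π_ξp, returnMap, S.wordComp_congr]
  intro i hi
  rw [ξp_natCast, Nat.mod_eq_of_lt hi]

theorem T_iterate_mul_π (n i : ℕ) (z : Circle1) :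
    S.T^[i * P.π n] (P.ξp n, z) = (P.ξp n, (P.returnMap n)^[i] z) := by
  induction i with
  | zero => simp
  | succ i ih =>
    rw [Nat.succ_mul, add_comm, Function.iterate_add_apply, ih, T_iterate_π,
      Function.iterate_succ_apply']

theorem wordComp_succ {n i r : ℕ} (hi : i < P.kseq (n + 1)) (hr : r < P.π n) (z : Circle1) :
    S.wordComp (P.w (n + 1)) (i * P.π n + r) z =
      S.wordComp (P.w n) r ((P.returnMap n)^[i] z) := by
  have hle : i * P.π n + r < P.kseq (n + 1) * P.π n := by nlinarith
  have h1 : S.T^[i * P.π n + r] (P.ξp n, z) = S.T^[r] (P.ξp n, (P.returnMap n)^[i] z) := by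
    rw [add_comm, Function.iterate_add_apply, T_iterate_mul_π]
  rw [S.T_iterate, S.T_iterate] at h1
  have h2 := congrArg Prod.snd h1
  dsimp only at h2
  rw [S.wordComp_congr (w := P.w (n + 1)) (w' := fun i => P.ξp n i), h2,
    S.wordComp_congr (w := P.w n) (w' := fun i => P.ξp n i)]
  · intro j hj
    rw [ξp_natCast, Nat.mod_eq_of_lt (hj.trans hr)]
  · intro j hj
    rw [ξp_natCast, P.word_eq n j (hj.trans hle)]

/-- The return map `g n` lifts near `J n` to a monotone contraction of `Icc (a n) (b n)`. -/
theorem exists_lift_returnMap (n : ℕ) : P.b n - P.a n < 1 ∧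
    ∃ (H : ℝ → ℝ) (p : ℝ), p ∈ Icc (P.a n) (P.b n) ∧ projCircle p = P.q n ∧ H p = p ∧
      StrictMono H ∧ (∀ x, P.returnMap n (projCircle x) = projCircle (H x)) ∧
      MapsTo H (Icc (P.a n) (P.b n)) (Icc (P.a n) (P.b n)) ∧
      ∀ x ∈ Icc (P.a n) (P.b n), ∀ y ∈ Icc (P.a n) (P.b n), x < y → H y - H x < y - x := by
  obtain ⟨p, hp, hpq⟩ := P.q_mem n
  set G := S.wordCompLift (P.w n) (P.π n) with hGdef
  have hG : StrictMono G := S.strictMono_wordCompLift _ _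
  have hlt : ∀ x ∈ Icc (P.a n) (P.b n), ∀ y ∈ Icc (P.a n) (P.b n), x < y →
      G y - G x < y - x := fun x hx y hy hxy =>
    sub_lt_sub_of_abs_deriv_lt_one (S.differentiable_wordCompLift _ _) hxy
      fun z hz => P.contracting n z ⟨hx.1.trans hz.1, hz.2.trans hy.2⟩
  obtain ⟨m, hm⟩ : ∃ m : ℤ, G p = p + m := by
    rw [← projCircle_eq_iff, ← S.wordComp_projCircle, hpq, P.fixed]
  have hab := P.a_lt_b n
  refine ⟨?_, fun x => G x - m, p, hp, hpq, by simp [hm], ?_, ?_, ?_, ?_⟩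
  · by_contra! hcon
    have h1 := hlt (P.a n) ⟨le_rfl, hab.le⟩ (P.a n + 1) ⟨by linarith, by linarith⟩ (by linarith)
    rw [hGdef, S.wordCompLift_add_one] at h1
    linarith
  · exact fun x y hxy => sub_lt_sub_right (hG hxy) _
  · intro x
    rw [returnMap, S.wordComp_projCircle, projCircle_eq_iff]
    exact ⟨-m, by push_cast; ring⟩
  · intro x hx
    rcases lt_trichotomy x p with h | rfl | h
    · have h1 := hlt x hx p hp h
      have h2 := hG h
      exact ⟨by linarith [hx.1], by linarith [hp.2]⟩
    · simpa [hm] using hx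
    · have h1 := hlt p hp x hx h
      have h2 := hG h
      exact ⟨by linarith [hp.1], by linarith [hx.2]⟩
  · intro x hx y hy hxy
    simpa using hlt x hx y hy hxy

theorem exists_lift_returnMap_iterate (n i : ℕ) {x y : ℝ} (hx : x ∈ Icc (P.a n) (P.b n))
    (hy : y ∈ Icc (P.a n) (P.b n)) :
    ∃ x' ∈ Icc (P.a n) (P.b n), ∃ y' ∈ Icc (P.a n) (P.b n), |x' - y'| ≤ |x - y| ∧
      (P.returnMap n)^[i] (projCircle x) = projCircle x' ∧
      (P.returnMap n)^[i] (projCircle y) = projCircle y' := by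
  obtain ⟨-, H, p, -, -, -, hmono, hH, hmaps, hlt⟩ := P.exists_lift_returnMap n
  induction i with
  | zero => exact ⟨x, hx, y, hy, le_rfl, rfl, rfl⟩
  | succ i ih =>
    obtain ⟨x', hx', y', hy', hle, h1, h2⟩ := ih
    refine ⟨H x', hmaps hx', H y', hmaps hy', le_trans ?_ hle, ?_, ?_⟩
    · rcases lt_trichotomy x' y' with h | rfl | h
      · have := hlt x' hx' y' hy' h
        have := hmono h
        rw [abs_of_neg (by linarith), abs_of_neg (by linarith)]
        linarith
      · simp
      · have := hlt y' hy' x' hx' h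
        have := hmono h
        rw [abs_of_pos (by linarith), abs_of_pos (by linarith)]
        linarith
    · rw [Function.iterate_succ_apply', h1, hH]
    · rw [Function.iterate_succ_apply', h2, hH]

/-- The only periodic point of `g n` in `J n` is `q n`. -/
theorem eq_q_of_isPeriodicPt {n m : ℕ} (hm : 0 < m) {z : Circle1}
    (hz : z ∈ projCircle '' Icc (P.a n) (P.b n))
    (h : Function.IsPeriodicPt (P.returnMap n) m z) : z = P.q n := by
  obtain ⟨hab, H, p, hp, hpq, hHp, hmono, hH, hmaps, hlt⟩ := P.exists_lift_returnMap n
  obtain ⟨x, hx, rfl⟩ := hz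
  have hiter : ∀ i, (P.returnMap n)^[i] (projCircle x) = projCircle (H^[i] x) := by
    intro i
    induction i with
    | zero => rfl
    | succ i ih => rw [Function.iterate_succ_apply', Function.iterate_succ_apply', ih, hH]
  have hmem : ∀ i, H^[i] x ∈ Icc (P.a n) (P.b n) := fun i => hmaps.iterate i hx
  have hfix : H^[m] x = x := by
    have h1 : projCircle (H^[m] x) = projCircle x := (hiter m).symm.trans h
    obtain ⟨c, hc⟩ := (projCircle_eq_iff _ _).1 h1
    have h2 := hmem m
    have h3 : ((-1 : ℤ) : ℝ) < c := by push_cast; linarith [hx.1, h2.2]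
    have h4 : (c : ℝ) < (1 : ℤ) := by push_cast; linarith [hx.2, h2.1]
    have : c = 0 := by
      have := Int.cast_lt.1 h3
      have := Int.cast_lt.1 h4
      omega
    rw [this, Int.cast_zero, add_zero] at hc
    exact hc.symm
  rw [← hpq]
  congr 1
  by_contra hne
  obtain ⟨m, rfl⟩ := Nat.exists_eq_succ_of_ne_zero hm.ne'
  rcases lt_or_gt_of_ne hne with hxp | hxp
  · have key : ∀ i, x < H^[i + 1] x ∧ H^[i + 1] x < p := by
      intro i
      induction i with
      | zero =>
        have := hlt x hx p hp hxp
        have := hmono hxp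
        simp only [zero_add, Function.iterate_one]
        constructor <;> linarith
      | succ i ih =>
        have := hlt _ (hmem (i + 1)) p hp ih.2
        have := hmono ih.2
        rw [Function.iterate_succ_apply']
        constructor <;> linarith [ih.1]
    exact (key m).1.ne' hfix
  · have key : ∀ i, H^[i + 1] x < x ∧ p < H^[i + 1] x := by
      intro i
      induction i with
      | zero =>
        have := hlt p hp x hx hxp
        have := hmono hxp
        simp only [zero_add, Function.iterate_one]
        constructor <;> linarith
      | succ i ih =>
        have := hlt p hp _ (hmem (i + 1)) ih.2
        have := hmono ih.2
        rw [Function.iterate_succ_apply']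
        constructor <;> linarith [ih.1]
    exact (key m).1.ne hfix

/-- The times `ℓ < π n` at which, at every level up to `n`, the orbit of `q n` follows a
complete repetition of the word of the previous level. -/
def goodIndices : ℕ → Finset ℕ
  | 0 => Finset.range (P.π 0)
  | n + 1 => (Finset.range (P.kseq (n + 1)) ×ˢ goodIndices n).image
      fun p => p.1 * P.π n + p.2

theorem mem_goodIndices_succ {n ℓ : ℕ} : ℓ ∈ P.goodIndices (n + 1) ↔
    ∃ i < P.kseq (n + 1), ∃ r ∈ P.goodIndices n, i * P.π n + r = ℓ := by
  simp [goodIndices, and_assoc]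

theorem lt_π_of_mem_goodIndices {n ℓ : ℕ} (h : ℓ ∈ P.goodIndices n) : ℓ < P.π n := by
  induction n generalizing ℓ with
  | zero => simpa [goodIndices] using h
  | succ n ih =>
    obtain ⟨i, hi, r, hr, rfl⟩ := P.mem_goodIndices_succ.1 h
    have := ih hr
    rw [P.period_eq]
    nlinarith

theorem card_goodIndices_succ (n : ℕ) :
    (P.goodIndices (n + 1)).card = P.kseq (n + 1) * (P.goodIndices n).card := by
  rw [goodIndices, Finset.card_image_of_injOn, Finset.card_product, Finset.card_range]
  rintro ⟨i, r⟩ h ⟨i', r'⟩ h' heq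
  simp only [Finset.coe_product, Finset.coe_range, mem_prod, mem_Iio, Finset.mem_coe] at h h' heq
  have hr := P.lt_π_of_mem_goodIndices h.2
  have hr' := P.lt_π_of_mem_goodIndices h'.2
  have h1 : r = r' := by
    have := congrArg (· % P.π n) heq
    simpa [Nat.mul_add_mod_self_right, Nat.mod_eq_of_lt hr, Nat.mod_eq_of_lt hr'] using this
  subst h1
  have h2 : i * P.π n = i' * P.π n := by omega
  rw [Nat.eq_of_mul_eq_mul_right (P.π_pos n) h2]

theorem exists_le_card_goodIndices :
    ∃ δ : ℝ, 0 < δ ∧ ∀ n, δ * P.π n ≤ (P.goodIndices n).card := by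
  set lam : ℕ → ℝ := fun n => (P.Rseq (n + 1) : ℝ) / (P.kseq (n + 1) * P.π n) with hlam
  have hnn : ∀ n, 0 ≤ lam n := fun n => by positivity
  have hpartial : ∀ n, Real.exp (-∑ j ∈ Finset.range n, lam j) * P.π n ≤
      (P.goodIndices n).card := by
    intro n
    induction n with
    | zero => simp [goodIndices]
    | succ n ih =>
      have hk : (0 : ℝ) < P.kseq (n + 1) := by
        have := P.kseq_ge n
        exact_mod_cast (by omega : 0 < P.kseq (n + 1))
      have hπ : (0 : ℝ) < P.π n := by exact_mod_cast P.π_pos n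
      have hπ' : (P.π (n + 1) : ℝ) = P.kseq (n + 1) * P.π n * (1 + lam n) := by
        rw [P.period_eq, hlam]
        push_cast
        field_simp
      have hexp : Real.exp (-lam n) * (1 + lam n) ≤ 1 := by
        rw [Real.exp_neg, inv_mul_le_one₀ (Real.exp_pos _)]
        linarith [Real.add_one_le_exp (lam n)]
      rw [card_goodIndices_succ, hπ', Finset.sum_range_succ, neg_add, Real.exp_add]
      push_cast
      calc _ = P.kseq (n + 1) * ((Real.exp (-∑ j ∈ Finset.range n, lam j) * P.π n) *
            (Real.exp (-lam n) * (1 + lam n))) := by ring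
        _ ≤ P.kseq (n + 1) * ((Real.exp (-∑ j ∈ Finset.range n, lam j) * P.π n) * 1) := by
            gcongr
        _ ≤ _ := by rw [mul_one]; gcongr
  refine ⟨Real.exp (-∑' j, lam j), Real.exp_pos _, fun n => le_trans ?_ (hpartial n)⟩
  gcongr
  exact P.lam_summable.sum_le_tsum _ fun j _ => hnn j

/-- The points whose base coordinate reads the word of `ξ n` from position `-ℓ` on and whose
fiber coordinate lies in the `ℓ`-th image of `J n`. -/
def block (n ℓ : ℕ) : Set (SkewM k) :=
  {z | (∀ j < P.π n, z.1 ((j : ℤ) - ℓ) = P.w n j) ∧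
    z.2 ∈ S.wordComp (P.w n) ℓ '' (projCircle '' Icc (P.a n) (P.b n))}

/-- The union of the blocks with good index. -/
def tower (n : ℕ) : Set (SkewM k) := ⋃ ℓ ∈ P.goodIndices n, P.block n ℓ

theorem isClosed_block (n ℓ : ℕ) : IsClosed (P.block n ℓ) := by
  refine IsClosed.and ?_ ?_
  · simp only [Set.ofPred_forall]
    refine isClosed_iInter fun j => isClosed_iInter fun _ => ?_
    exact isClosed_eq ((continuous_apply _).comp continuous_fst) continuous_const
  · exact (((isCompact_Icc.image continuous_projCircle).image
      (S.continuous_wordComp _ _)).isClosed).preimage continuous_snd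

theorem isClosed_tower (n : ℕ) : IsClosed (P.tower n) :=
  (P.goodIndices n).finite_toSet.isClosed_biUnion fun ℓ _ => P.isClosed_block n ℓ

theorem block_succ_subset {n i r : ℕ} (hi : i < P.kseq (n + 1)) (hr : r < P.π n) :
    P.block (n + 1) (i * P.π n + r) ⊆ P.block n r := by
  rintro ⟨ξ, z⟩ ⟨h1, h2⟩
  refine ⟨fun j hj => ?_, ?_⟩
  · have hlt : i * P.π n + j < P.kseq (n + 1) * P.π n := by nlinarith
    have h3 := h1 (i * P.π n + j) (by rw [P.period_eq]; omega)
    rw [P.word_eq n _ hlt, Nat.mul_add_mod_self_right, Nat.mod_eq_of_lt hj] at h3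
    rw [← h3]
    dsimp only
    congr 1
    push_cast
    ring
  · obtain ⟨_, ⟨x, hx, rfl⟩, hz⟩ := h2
    have hx' := P.nested n hx
    obtain ⟨x', hx', -, -, -, h3, -⟩ := P.exists_lift_returnMap_iterate n i hx' hx'
    rw [P.wordComp_succ hi hr, h3] at hz
    exact ⟨_, ⟨x', hx', rfl⟩, hz⟩

theorem antitone_tower : Antitone P.tower := by
  refine antitone_nat_of_succ_le fun n z hz => ?_
  simp only [tower, mem_iUnion] at hz ⊢
  obtain ⟨ℓ, hℓ, hz⟩ := hz
  obtain ⟨i, hi, r, hr, rfl⟩ := P.mem_goodIndices_succ.1 hℓ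
  exact ⟨r, hr, P.block_succ_subset hi (P.lt_π_of_mem_goodIndices hr) hz⟩

theorem T_iterate_mem_block {n ℓ : ℕ} (hℓ : ℓ < P.π n) :
    S.T^[ℓ] (P.ξp n, P.q n) ∈ P.block n ℓ := by
  rw [S.T_iterate]
  refine ⟨fun j hj => ?_, P.q n, P.q_mem n, ?_⟩
  · simp only [shiftMap_iterate_apply, sub_add_cancel, ξp_natCast, Nat.mod_eq_of_lt hj]
  · dsimp only
    rw [S.wordComp_congr]
    intro j hj
    rw [ξp_natCast, Nat.mod_eq_of_lt (hj.trans hℓ)]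

theorem exists_wordComp_zero {n ℓ : ℕ} (hℓ : ℓ ∈ P.goodIndices n) {x y : ℝ}
    (hx : x ∈ Icc (P.a n) (P.b n)) (hy : y ∈ Icc (P.a n) (P.b n)) :
    ∃ ℓ₀ < P.π 0, ∃ x' y' : ℝ, |x' - y'| ≤ |x - y| ∧
      S.wordComp (P.w n) ℓ (projCircle x) = S.wordComp (P.w 0) ℓ₀ (projCircle x') ∧
      S.wordComp (P.w n) ℓ (projCircle y) = S.wordComp (P.w 0) ℓ₀ (projCircle y') := by
  induction n generalizing ℓ x y with
  | zero => exact ⟨ℓ, P.lt_π_of_mem_goodIndices hℓ, x, y, le_rfl, rfl, rfl⟩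
  | succ n ih =>
    obtain ⟨i, hi, r, hr, rfl⟩ := P.mem_goodIndices_succ.1 hℓ
    have hr' := P.lt_π_of_mem_goodIndices hr
    obtain ⟨x', hx', y', hy', hle, h1, h2⟩ :=
      P.exists_lift_returnMap_iterate n i (P.nested n hx) (P.nested n hy)
    obtain ⟨ℓ₀, hℓ₀, x'', y'', hle', h3, h4⟩ := ih hr hx' hy'
    refine ⟨ℓ₀, hℓ₀, x'', y'', hle'.trans hle, ?_, ?_⟩
    · rw [P.wordComp_succ hi hr', h1, h3]
    · rw [P.wordComp_succ hi hr', h2, h4]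

/-- Images of `J n` at good times are uniformly small for large `n`. -/
theorem eventually_dist_lt {ε : ℝ} (hε : 0 < ε) : ∀ᶠ n in atTop, ∀ ℓ ∈ P.goodIndices n,
    ∀ z ∈ P.block n ℓ, ∀ z' ∈ P.block n ℓ, dist z.2 z'.2 < ε := by
  have huc : UniformContinuous fun z : Circle1 =>
      fun ℓ : Fin (P.π 0) => S.wordComp (P.w 0) ℓ z :=
    CompactSpace.uniformContinuous_of_continuous
      (continuous_pi fun ℓ => S.continuous_wordComp _ _)
  obtain ⟨η, hη, huc⟩ := Metric.uniformContinuous_iff.1 huc ε hε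
  filter_upwards [P.len_to_zero.eventually_lt_const hη] with n hn ℓ hℓ z hz z' hz'
  obtain ⟨-, _, ⟨x, hx, rfl⟩, hxz⟩ := hz
  obtain ⟨-, _, ⟨y, hy, rfl⟩, hyz⟩ := hz'
  obtain ⟨ℓ₀, hℓ₀, x', y', hle, h1, h2⟩ := P.exists_wordComp_zero hℓ hx hy
  have hxy : |x - y| ≤ P.b n - P.a n := by
    rw [abs_le]
    constructor <;> linarith [hx.1, hx.2, hy.1, hy.2]
  have h3 := huc (((dist_projCircle_le x' y').trans (hle.trans hxy)).trans_lt hn)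
  have h4 := (dist_pi_lt_iff hε).1 h3 ⟨ℓ₀, hℓ₀⟩
  rwa [← hxz, ← hyz, h1, h2]

instance isProbabilityMeasure_μX (n : ℕ) : IsProbabilityMeasure (P.μX n) := by
  constructor
  have h : (P.π n : ℝ≥0∞) ≠ 0 := by exact_mod_cast (P.π_pos n).ne'
  simp [μX, ENNReal.inv_mul_cancel h]

theorem le_μX {n : ℕ} {E : Set (SkewM k)} {s : Finset ℕ} (hs : ∀ ℓ ∈ s, ℓ < P.π n)
    (hE : MeasurableSet E) (h : ∀ ℓ ∈ s, S.T^[ℓ] (P.ξp n, P.q n) ∈ E) :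
    (P.π n : ℝ≥0∞)⁻¹ * s.card ≤ P.μX n E := by
  rw [μX, Measure.smul_apply, smul_eq_mul, Measure.finsetSum_apply]
  gcongr
  calc (s.card : ℝ≥0∞) = ∑ ℓ ∈ s, Measure.dirac (S.T^[ℓ] (P.ξp n, P.q n)) E := by
        rw [Finset.sum_congr rfl fun ℓ hℓ => ?_, Finset.sum_const, nsmul_one]
        rw [Measure.dirac_apply' _ hE, indicator_of_mem (h ℓ hℓ), Pi.one_apply]
    _ ≤ _ := Finset.sum_le_sum_of_subset fun ℓ hℓ => Finset.mem_range.2 (hs ℓ hℓ)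

theorem le_μX_tower {δ : ℝ} (hδ : ∀ n, δ * P.π n ≤ (P.goodIndices n).card) (n : ℕ) :
    ENNReal.ofReal δ ≤ P.μX n (P.tower n) := by
  refine le_trans ?_ (P.le_μX (fun ℓ hℓ => P.lt_π_of_mem_goodIndices hℓ)
    (P.isClosed_tower n).measurableSet fun ℓ hℓ => mem_biUnion hℓ
      (P.T_iterate_mem_block (P.lt_π_of_mem_goodIndices hℓ)))
  have hπ : (P.π n : ℝ≥0∞) ≠ 0 := by exact_mod_cast (P.π_pos n).ne'
  rw [mul_comm, ← div_eq_mul_inv, ENNReal.le_div_iff_mul_le (Or.inl hπ) (Or.inl (by simp))]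
  rw [← ENNReal.ofReal_natCast, ← ENNReal.ofReal_natCast, ← ENNReal.ofReal_mul' (by positivity)]
  exact ENNReal.ofReal_le_ofReal (hδ n)

theorem le_measure_of_isClosed {μ : Measure (SkewM k)} [IsProbabilityMeasure μ]
    (hμ : WeakStarTendsto (fun n => P.μX n) μ) {E : Set (SkewM k)} (hE : IsClosed E)
    {δ : ℝ≥0∞} (h : ∀ᶠ n in atTop, δ ≤ P.μX n E) : δ ≤ μ E := by
  let μs : ℕ → ProbabilityMeasure (SkewM k) := fun n => ⟨P.μX n, inferInstance⟩
  let μ' : ProbabilityMeasure (SkewM k) := ⟨μ, inferInstance⟩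
  have hlim : Tendsto μs atTop (nhds μ') := by
    rw [ProbabilityMeasure.tendsto_iff_forall_integral_tendsto]
    exact fun g => hμ g.toContinuousMap
  refine le_trans ?_ (ProbabilityMeasure.limsup_measure_closed_le_of_tendsto hlim hE)
  exact le_limsup_of_frequently_le h.frequently

/-- The minimal period of the sequence `ξ n`. -/
def minPeriod (n : ℕ) : ℕ := Function.minimalPeriod (shiftMap k) (P.ξp n)

theorem isPeriodicPt_ξp (n : ℕ) : Function.IsPeriodicPt (shiftMap k) (P.π n) (P.ξp n) :=
  P.shiftMap_iterate_π_ξp n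

theorem minPeriod_pos (n : ℕ) : 0 < P.minPeriod n :=
  (P.isPeriodicPt_ξp n).minimalPeriod_pos (P.π_pos n)

theorem minPeriod_dvd_π (n : ℕ) : P.minPeriod n ∣ P.π n :=
  (P.isPeriodicPt_ξp n).minimalPeriod_dvd

theorem isPeriodicPt_shiftMap_of_forall_lt {n d : ℕ}
    (h : ∀ j < P.π n, P.ξp n ((j + d : ℕ) : ℤ) = P.ξp n j) :
    Function.IsPeriodicPt (shiftMap k) d (P.ξp n) := by
  have hπ : (0 : ℤ) < P.π n := by exact_mod_cast P.π_pos n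
  funext i
  rw [shiftMap_iterate_apply]
  obtain ⟨j, hj⟩ := Int.eq_ofNat_of_zero_le (Int.emod_nonneg i hπ.ne')
  have hjlt : j < P.π n := by
    have := Int.emod_lt_of_pos i hπ
    omega
  have h1 : P.ξp n (i + d) = P.ξp n ((j + d : ℕ) : ℤ) := by
    simp only [ξp]
    congr 2
    push_cast
    rw [← hj, Int.emod_add_emod]
  have h2 : P.ξp n i = P.ξp n j := by
    simp only [ξp]
    congr 2
    rw [← hj, Int.emod_emod]
  rw [h1, h2, h j hjlt]

theorem minPeriod_dvd_sub {n ℓ d : ℕ} {z z' : SkewM k} (hz : z ∈ P.block (n + 1) ℓ)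
    (hz' : z' ∈ P.block (n + 1) (ℓ + d)) (h : z.1 = z'.1)
    (hd : P.π n + d ≤ P.kseq (n + 1) * P.π n) : P.minPeriod n ∣ d := by
  refine (P.isPeriodicPt_shiftMap_of_forall_lt fun j hj => ?_).minimalPeriod_dvd
  have hπ := P.period_eq n
  rw [ξp_natCast, ξp_natCast, ← P.word_eq n (j + d) (by omega), ← P.word_eq n j (by omega),
    ← hz.1 j (by omega), ← hz'.1 (j + d) (by omega), h]
  rw [show ((j + d : ℕ) : ℤ) - (ℓ + d : ℕ) = j - ℓ by push_cast; ring]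

theorem ξp_succ_eq {n : ℕ} (h : P.π n + P.minPeriod (n + 1) ≤ P.kseq (n + 1) * P.π n) :
    P.ξp (n + 1) = P.ξp n := by
  set t := P.minPeriod (n + 1) with ht
  have ht0 : (0 : ℤ) < t := by exact_mod_cast P.minPeriod_pos (n + 1)
  have hper : Function.IsPeriodicPt (shiftMap k) t (P.ξp (n + 1)) :=
    Function.isPeriodicPt_minimalPeriod _ _
  have hper' : Function.IsPeriodicPt (shiftMap k) t (P.ξp n) := by
    refine P.isPeriodicPt_shiftMap_of_forall_lt fun j hj => ?_
    rw [← P.ξp_succ_natCast (n := n) (i := j + t) (by omega),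
      ← P.ξp_succ_natCast (n := n) (i := j) (by omega)]
    have := congrFun hper j
    rw [shiftMap_iterate_apply] at this
    exact_mod_cast this
  have hmod : ∀ ξ : Shift k, Function.IsPeriodicPt (shiftMap k) t ξ →
      ∀ i : ℤ, ξ i = ξ (i % t) := by
    intro ξ hξ i
    have hp : Function.Periodic ξ (t : ℤ) := fun i => by
      rw [← shiftMap_iterate_apply k t ξ i]
      exact congrFun hξ i
    have := hp.int_mul (i / t) (i % t)
    rw [← this]
    congr 1
    rw [mul_comm]
    exact (Int.emod_add_mul_ediv i t).symm
  funext i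
  rw [hmod _ hper, hmod _ hper']
  obtain ⟨j, hj⟩ := Int.eq_ofNat_of_zero_le (Int.emod_nonneg i ht0.ne')
  have hjlt : j < t := by
    have := Int.emod_lt_of_pos i ht0
    omega
  rw [hj]
  exact P.ξp_succ_natCast (by omega)

theorem block_subset_of_mem_goodIndices {n ℓ : ℕ} (hℓ : ℓ ∈ P.goodIndices (n + 1)) :
    ℓ < P.kseq (n + 1) * P.π n ∧ ℓ % P.π n ∈ P.goodIndices n ∧
      P.block (n + 1) ℓ ⊆ P.block n (ℓ % P.π n) := by
  obtain ⟨i, hi, r, hr, rfl⟩ := P.mem_goodIndices_succ.1 hℓ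
  have hlt := P.lt_π_of_mem_goodIndices hr
  rw [Nat.mul_add_mod_self_right, Nat.mod_eq_of_lt hlt]
  exact ⟨by nlinarith, hr, P.block_succ_subset hi hlt⟩

/-- If infinitely many of the words are at most squares of primitive words, then the fibers of
the intersection of the towers are finite. -/
theorem finite_fiber_iInter_tower (h : ∃ᶠ n in atTop, P.π n ≤ 2 * P.minPeriod n) (ξ : Shift k) :
    {x : Circle1 | (ξ, x) ∈ ⋂ n, P.tower n}.Finite := by
  refine finite_of_forall_exists_coloring (p := 4) fun ε hε => ?_
  obtain ⟨n, hn, hsmall⟩ := (h.and_eventually (P.eventually_dist_lt hε)).exists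
  have hblock : ∀ x ∈ {x : Circle1 | (ξ, x) ∈ ⋂ n, P.tower n},
      ∃ ℓ ∈ P.goodIndices (n + 1), (ξ, x) ∈ P.block (n + 1) ℓ := by
    intro x hx
    simpa [tower] using mem_iInter.1 hx (n + 1)
  choose! ℓ hℓ hmem using hblock
  have hτ := P.minPeriod_pos n
  have hquot : ∀ x, ℓ x % P.π n / P.minPeriod n < 2 := fun x =>
    (Nat.div_lt_iff_lt_mul hτ).2 ((Nat.mod_lt _ (P.π_pos n)).trans_le hn)
  refine ⟨fun x => (if 2 * ℓ x < P.kseq (n + 1) * P.π n then 0 else 2) +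
    ℓ x % P.π n / P.minPeriod n, fun x _ => ?_, fun x hx y hy hxy => ?_⟩
  · have := hquot x
    dsimp only
    split_ifs <;> omega
  · dsimp only at hxy
    wlog hle : ℓ x ≤ ℓ y generalizing x y
    · rw [dist_comm]
      exact this y hy x hx hxy.symm (le_of_not_ge hle)
    obtain ⟨d, hd⟩ := Nat.exists_eq_add_of_le hle
    have hLx := P.block_subset_of_mem_goodIndices (hℓ x hx)
    have hLy := P.block_subset_of_mem_goodIndices (hℓ y hy)
    have hqx := hquot x
    have hqy := hquot y
    have h2 : 2 * P.π n ≤ P.kseq (n + 1) * P.π n := Nat.mul_le_mul_right _ (P.kseq_ge n)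
    obtain ⟨hhalf, hq⟩ : (2 * ℓ x < P.kseq (n + 1) * P.π n ↔ 2 * ℓ y < P.kseq (n + 1) * P.π n) ∧
        ℓ x % P.π n / P.minPeriod n = ℓ y % P.π n / P.minPeriod n := by
      generalize ℓ x % P.π n / P.minPeriod n = u at *
      generalize ℓ y % P.π n / P.minPeriod n = v at *
      split_ifs at hxy <;> omega
    have hmem_y := hmem y hy
    rw [hd] at hmem_y
    have hdvd : P.minPeriod n ∣ d := by
      refine P.minPeriod_dvd_sub (hmem x hx) hmem_y rfl ?_
      have := hLy.1
      omega
    have hmod : ℓ x % P.π n % P.minPeriod n = ℓ y % P.π n % P.minPeriod n := by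
      rw [Nat.mod_mod_of_dvd _ (P.minPeriod_dvd_π n), Nat.mod_mod_of_dvd _ (P.minPeriod_dvd_π n),
        hd, Nat.add_mod, Nat.mod_eq_zero_of_dvd hdvd, add_zero, Nat.mod_mod]
    have hr : ℓ x % P.π n = ℓ y % P.π n := by
      rw [← Nat.div_add_mod (ℓ x % P.π n) (P.minPeriod n), hq, hmod, Nat.div_add_mod]
    exact hsmall _ hLy.2.1 (ξ, x) (hr ▸ hLx.2.2 (hmem x hx)) (ξ, y) (hLy.2.2 (hmem y hy))

theorem eventually_two_mul_Rseq_le :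
    ∀ᶠ n in atTop, 2 * P.Rseq (n + 1) ≤ P.kseq (n + 1) * P.π n := by
  filter_upwards [P.lam_summable.tendsto_atTop_zero.eventually_lt_const
    (by norm_num : (0 : ℝ) < 1 / 2)] with n hn
  have hk : 0 < P.kseq (n + 1) * P.π n :=
    Nat.mul_pos (by have := P.kseq_ge n; omega) (P.π_pos n)
  have hk' : (0 : ℝ) < P.kseq (n + 1) * P.π n := by exact_mod_cast hk
  rw [div_lt_iff₀ hk'] at hn
  have h : (2 * P.Rseq (n + 1) : ℝ) ≤ P.kseq (n + 1) * P.π n := by linarith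
  exact_mod_cast h

/-- If all words of high level are at least cubes, then the periodic points are eventually
constant. -/
theorem exists_forall_ge_eq (h : ∀ᶠ n in atTop, 2 * P.minPeriod n < P.π n) :
    ∃ N, ∀ n ≥ N, P.ξp n = P.ξp N ∧ P.q n = P.q N := by
  obtain ⟨N, hN⟩ := eventually_atTop.1 (h.and P.eventually_two_mul_Rseq_le)
  have hξ : ∀ n ≥ N, P.ξp n = P.ξp N := by
    intro n hn
    induction n, hn using Nat.le_induction with
    | base => rfl
    | succ n hn ih =>
      rw [← ih]
      refine P.ξp_succ_eq ?_
      obtain ⟨c, hc⟩ := P.minPeriod_dvd_π (n + 1)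
      have h1 := (hN (n + 1) (by omega)).1
      have h2 := (hN n hn).2
      have h3 : 2 * P.π n ≤ P.kseq (n + 1) * P.π n := Nat.mul_le_mul_right _ (P.kseq_ge n)
      have h4 := P.period_eq n
      have h5 : 2 < c := by
        by_contra! hcon
        have := Nat.mul_le_mul_left (P.minPeriod (n + 1)) hcon
        omega
      have h6 := Nat.mul_le_mul_left (P.minPeriod (n + 1)) h5
      omega
  refine ⟨N, fun n hn => ⟨hξ n hn, ?_⟩⟩
  refine P.eq_q_of_isPeriodicPt (P.π_pos n) ?_ ?_
  · have hmono : Antitone fun n => Icc (P.a n) (P.b n) := antitone_nat_of_succ_le P.nested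
    exact image_mono (hmono hn) (P.q_mem n)
  · have h1 : Function.IsPeriodicPt S.T (P.π n) (P.ξp n, P.q n) := by
      rw [Function.IsPeriodicPt, Function.IsFixedPt, T_iterate_π, returnMap, P.fixed]
    have h2 := h1.mul_const (P.π N)
    rw [hξ n hn, Function.IsPeriodicPt, Function.IsFixedPt, T_iterate_mul_π] at h2
    exact congrArg Prod.snd h2

theorem exists_isClosed_finite_fibers {μ : Measure (SkewM k)} [IsProbabilityMeasure μ]
    (hμ : WeakStarTendsto (fun n => P.μX n) μ) :
    ∃ E : Set (SkewM k), IsClosed E ∧ 0 < μ E ∧ ∀ ξ, {x : Circle1 | (ξ, x) ∈ E}.Finite := by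
  by_cases hfreq : ∃ᶠ n in atTop, P.π n ≤ 2 * P.minPeriod n
  · obtain ⟨δ, hδ, hcard⟩ := P.exists_le_card_goodIndices
    refine ⟨⋂ n, P.tower n, isClosed_iInter P.isClosed_tower, ?_,
      P.finite_fiber_iInter_tower hfreq⟩
    refine (ENNReal.ofReal_pos.2 hδ).trans_le ?_
    rw [P.antitone_tower.measure_iInter
      (fun n => (P.isClosed_tower n).measurableSet.nullMeasurableSet) ⟨0, measure_ne_top _ _⟩]
    refine le_iInf fun n => P.le_measure_of_isClosed hμ (P.isClosed_tower n) ?_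
    filter_upwards [eventually_ge_atTop n] with m hm
    exact (P.le_μX_tower hcard m).trans (measure_mono (P.antitone_tower hm))
  · simp only [not_frequently, not_le] at hfreq
    obtain ⟨N, hN⟩ := P.exists_forall_ge_eq hfreq
    set E : Set (SkewM k) := (fun ℓ => S.T^[ℓ] (P.ξp N, P.q N)) '' Iio (P.π N) with hEdef
    have hEfin : E.Finite := (finite_Iio _).image _
    have hmem : ∀ ℓ, S.T^[ℓ] (P.ξp N, P.q N) ∈ E := by
      intro ℓ
      have hper : Function.IsPeriodicPt S.T (P.π N) (P.ξp N, P.q N) := by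
        rw [Function.IsPeriodicPt, Function.IsFixedPt, T_iterate_π, returnMap, P.fixed]
      exact ⟨ℓ % P.π N, Nat.mod_lt _ (P.π_pos N), hper.iterate_mod_apply ℓ⟩
    refine ⟨E, hEfin.isClosed, zero_lt_one.trans_le ?_,
      fun ξ => hEfin.preimage (Prod.mk_right_injective ξ).injOn⟩
    refine P.le_measure_of_isClosed hμ hEfin.isClosed ?_
    filter_upwards [eventually_ge_atTop N] with n hn
    have h := P.le_μX (n := n) (s := Finset.range (P.π n)) (fun ℓ => Finset.mem_range.1)
      hEfin.measurableSet fun ℓ _ => by rw [(hN n hn).1, (hN n hn).2]; exact hmem ℓ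
    have hπ : (P.π n : ℝ≥0∞) ≠ 0 := by exact_mod_cast (P.π_pos n).ne'
    rwa [Finset.card_range, ENNReal.inv_mul_cancel hπ (by simp)] at h

end RepetitivePattern

theorem exists_atoms_of_finite_fibers {k : ℕ} {μ : Measure (SkewM k)} {ν : Measure (Shift k)}
    {md : Shift k → Measure (SkewM k)} (hdis : IsDisintegration μ ν md) {E : Set (SkewM k)}
    (hE : MeasurableSet E) (hpos : 0 < μ E) (hfin : ∀ ξ, {x : Circle1 | (ξ, x) ∈ E}.Finite) :
    ∃ W : Set (Shift k), MeasurableSet W ∧ 0 < ν W ∧ ∀ ξ ∈ W, ∃ z : SkewM k, 0 < md ξ {z} := by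
  obtain ⟨h1, h2, h3⟩ := hdis
  obtain ⟨φ, hφ, hle, hint⟩ := exists_measurable_le_lintegral_eq ν fun ξ => md ξ E
  have hφpos : ν {ξ | φ ξ ≠ 0} ≠ 0 := by
    rw [h3 E hE, hint, pos_iff_ne_zero, ne_eq, lintegral_eq_zero_iff hφ] at hpos
    exact hpos
  have hae : ∀ᵐ ξ ∂ν, IsProbabilityMeasure (md ξ) ∧ md ξ ({ξ} ×ˢ univ) = 1 := h1.and h2
  obtain ⟨G, hGsub, hGmeas, hGnull⟩ := exists_measurable_superset_of_null hae
  refine ⟨{ξ | φ ξ ≠ 0} \ G, (measurableSet_eq_fun hφ measurable_const).compl.diff hGmeas, ?_, ?_⟩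
  · rw [measure_sdiff_null hGnull]
    exact pos_iff_ne_zero.2 hφpos
  · rintro ξ ⟨hξ, hξG⟩
    obtain ⟨hp, hfib⟩ : IsProbabilityMeasure (md ξ) ∧ md ξ ({ξ} ×ˢ univ) = 1 := by
      by_contra hcon
      exact hξG (hGsub hcon)
    by_contra! hno
    have hnull : md ξ (Prod.mk ξ '' {x : Circle1 | (ξ, x) ∈ E}) = 0 := by
      rw [← biUnion_of_singleton (Prod.mk ξ '' _),
        measure_biUnion_null_iff ((hfin ξ).image _).countable]
      exact fun z _ => le_antisymm (hno z) zero_le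
    have hcompl : md ξ ({ξ} ×ˢ univ)ᶜ = 0 :=
      (prob_compl_eq_zero_iff ((measurableSet_singleton ξ).prod MeasurableSet.univ)).2 hfib
    have hE0 : md ξ E = 0 := by
      refine measure_mono_null ?_ (measure_union_null hnull hcompl)
      rintro ⟨η, x⟩ hz
      by_cases hη : η = ξ
      · subst hη
        exact Or.inl ⟨x, hz, rfl⟩
      · exact Or.inr fun hmem => hη hmem.1
    exact hξ (le_antisymm ((hle ξ).trans_eq hE0) zero_le)

/-- A probability measure with periodic repetitive pattern has atoms in
its disintegration: there is a positive-measure set `W` of base points over which the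
conditional measure has an atom. -/
theorem hasAtoms_of_periodicRepetitivePattern
    {k : ℕ} (S : SkewSetup k) (μ : Measure (SkewM k))
    (hprob : IsProbabilityMeasure μ)
    (hpat : HasPeriodicRepetitivePattern S μ)
    (md : Shift k → Measure (SkewM k))
    (hdis : IsDisintegration μ (μ.map Prod.fst) md) :
    ∃ W : Set (Shift k), MeasurableSet W ∧ 0 < μ.map Prod.fst W ∧
      ∀ ξ ∈ W, ∃ z : SkewM k, 0 < md ξ {z} := by
  obtain ⟨P, hP⟩ := hpat
  obtain ⟨E, hE, hpos, hfin⟩ := P.exists_isClosed_finite_fibers hP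
  exact exists_atoms_of_finite_fibers hdis hE.measurableSet hpos hfin

end
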